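/- Let G = (V, D, ∅) be a mixed graph with no bidirected edges, with indeterminate matrices Λ (supported on D) and diagonal Ω. Let D_L, D_R ⊂ D, let Λ^L, Λ^R be the restrictions of Λ to D_L and D_R, and let Γ = (I − Λ^L)⁻ᵀ Ω (I − Λ^R)⁻¹ as formal power series. Then for S, T ⊂ V with |S| = |T| = k, the determinant |Γ_{S,T}| is the zero power series if and only if every system of k treks from S to T that avoids D∖D_L on the left and D∖D_R on the right has a sided intersection. -/

import Mathlib

open scoped BigOperators

/-- A mixed graph on `n` vertices: directed edges `D` and symmetric bidirected
edges `B`, with no self-loops. -/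
structure MixedGraph (n : ℕ) where
  D : Fin n → Fin n → Prop
  B : Fin n → Fin n → Prop
  B_symm : ∀ i j, B i j → B j i
  D_irrefl : ∀ i, ¬ D i i
  B_irrefl : ∀ i, ¬ B i i

namespace MixedGraph

variable {n : ℕ}

/-- A trek from `v` to `w` in a mixed graph: a walk with no colliding arrowheads,
consisting of a left-hand side `L 0 = v, L 1, …, L p` (each step along a directed
edge `L (i+1) → L i`, traversed backwards from `v` up to the top `L p`),
then either (`bid = true`) one bidirected edge `L p ↔ R 0`, or (`bid = false`)
`L p = R 0`, and a right-hand side `R 0, …, R q = w` walking forwards along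
directed edges `R j → R (j+1)`.  Vertices may repeat (treks are walks). -/
structure Trek (G : MixedGraph n) (v w : Fin n) where
  p : ℕ
  q : ℕ
  L : Fin (p + 1) → Fin n
  R : Fin (q + 1) → Fin n
  hL : ∀ i : Fin p, G.D (L i.succ) (L i.castSucc)
  hR : ∀ i : Fin q, G.D (R i.castSucc) (R i.succ)
  bid : Bool
  hconn : if bid then G.B (L (Fin.last p)) (R 0) else L (Fin.last p) = R 0
  hv : L 0 = v
  hw : R (Fin.last q) = w

namespace Trek

variable {G : MixedGraph n} {v w : Fin n}

/-- The vertices on the left-hand side of a trek (including the top). -/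
def leftVerts (π : Trek G v w) : Set (Fin n) := Set.range π.L

/-- The vertices on the right-hand side of a trek (including the top). -/
def rightVerts (π : Trek G v w) : Set (Fin n) := Set.range π.R

/-- The trek monomial of a trek, with respect to parameter matrices
`lam` (directed edge coefficients) and `om` (error covariances):
`ω_{top-left, top-right} ∏ λ_{x y}` over all directed edges of the trek. -/
def monom {R' : Type*} [CommSemiring R'] (lam om : Fin n → Fin n → R')
    (π : Trek G v w) : R' :=
  om (π.L (Fin.last π.p)) (π.R 0)
    * (∏ i : Fin π.p, lam (π.L i.succ) (π.L i.castSucc))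
    * ∏ i : Fin π.q, lam (π.R i.castSucc) (π.R i.succ)

/-- A half-trek is a trek whose left-hand side consists of a single vertex. -/
def IsHalfTrek (π : Trek G v w) : Prop := π.p = 0

/-- The trek uses the directed edge `a → b` on its left-hand side. -/
def usesLeft (π : Trek G v w) (a b : Fin n) : Prop :=
  ∃ i : Fin π.p, π.L i.succ = a ∧ π.L i.castSucc = b

/-- The trek uses the directed edge `a → b` on its right-hand side. -/
def usesRight (π : Trek G v w) (a b : Fin n) : Prop :=
  ∃ i : Fin π.q, π.R i.castSucc = a ∧ π.R i.succ = b

/-- The trek is non-empty (uses at least one edge). -/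
def Nonemp (π : Trek G v w) : Prop := 0 < π.p ∨ 0 < π.q ∨ π.bid = true

end Trek

/-- `w` is trek reachable from `v`: there is a non-empty trek from `v` to `w`. -/
def tr (G : MixedGraph n) (v w : Fin n) : Prop :=
  ∃ π : Trek G v w, π.Nonemp

/-- `w` is half-trek reachable from `v`. -/
def htr (G : MixedGraph n) (v w : Fin n) : Prop :=
  ∃ π : Trek G v w, π.IsHalfTrek ∧ π.Nonemp

/-- `w` is a descendant of `v` (non-empty directed path from `v` to `w`). -/
def des (G : MixedGraph n) (v w : Fin n) : Prop :=
  Relation.TransGen G.D v w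

/-- The parents of `w`. -/
def pa (G : MixedGraph n) (w : Fin n) : Set (Fin n) := {z | G.D z w}

/-- The siblings of `w`. -/
def sib (G : MixedGraph n) (w : Fin n) : Set (Fin n) := {z | G.B z w}

end MixedGraph

/-! ### STATEMENT 12: vanishing of determinants and avoiding trek systems
(no bidirected edges) -/

open Matrix MixedGraph

noncomputable instance mvPowerSeriesTop (σ : Type*) : TopologicalSpace (MvPowerSeries σ ℚ) :=
  Pi.topologicalSpace

theorem X_ne_zero_aux {σ : Type*} (s : σ) : (MvPowerSeries.X s : MvPowerSeries σ ℚ) ≠ 0 := by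
  classical
  intro h
  have := congrArg (MvPowerSeries.coeff (Finsupp.single s 1)) h
  simp [MvPowerSeries.coeff_X] at this

/-- Ring endomorphism of power series killing all variables outside `E`. -/
theorem exists_kill {σ : Type*} [Finite σ] (E : σ → Prop) :
    ∃ φ : MvPowerSeries σ ℚ →+* MvPowerSeries σ ℚ,
      (∀ s, E s → φ (MvPowerSeries.X s) = MvPowerSeries.X s) ∧
      (∀ s, ¬ E s → φ (MvPowerSeries.X s) = 0) := by
  classical
  have ha : MvPowerSeries.HasSubst
      (fun s : σ => if E s then (MvPowerSeries.X s : MvPowerSeries σ ℚ) else 0) := by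
    apply MvPowerSeries.hasSubst_of_constantCoeff_zero
    intro s
    split_ifs <;> simp
  refine ⟨(MvPowerSeries.substAlgHom (R := ℚ) ha).toRingHom, ?_, ?_⟩
  · intro s hs
    have := MvPowerSeries.substAlgHom_X (R := ℚ) ha s
    simpa [hs] using this
  · intro s hs
    have := MvPowerSeries.substAlgHom_X (R := ℚ) ha s
    simpa [hs] using this

/-- The geometric series inverts `1 - M`. -/
theorem one_sub_mul_geom {σ : Type*} {n : ℕ}
    (M A : Matrix (Fin n) (Fin n) (MvPowerSeries σ ℚ))
    (hA : ∀ i j, HasSum (fun m : ℕ => (M ^ m) i j) (A i j)) : (1 - M) * A = 1 := by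
  have : IsTopologicalRing (MvPowerSeries σ ℚ) :=
    MvPowerSeries.WithPiTopology.instIsTopologicalRing σ ℚ
  have : T2Space (MvPowerSeries σ ℚ) := MvPowerSeries.WithPiTopology.instT2Space
  have key : M * A = A - 1 := by
    ext1 i j
    have h1 : HasSum (fun m : ℕ => (M ^ (m + 1)) i j) ((M * A) i j) := by
      simp only [pow_succ', Matrix.mul_apply]
      exact hasSum_sum (fun l _ => (hA l j).mul_left (M i l))
    have h2 : HasSum (fun m : ℕ => (M ^ (m + 1)) i j) ((A - 1) i j) := by
      rw [hasSum_nat_add_iff (f := fun m : ℕ => (M ^ m) i j) 1]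
      simpa using hA i j
    exact h1.unique h2
  rw [sub_mul, one_mul, key, sub_sub_cancel]

/-- Loop erasure. -/
theorem exists_simple_walk {V : Type*} (E : V → V → Prop) (p : ℕ) (w : ℕ → V)
    (hw : ∀ t < p, E (w t) (w (t + 1))) :
    ∃ (p' : ℕ) (w' : ℕ → V), w' 0 = w 0 ∧ w' p' = w p ∧
      (∀ t < p', E (w' t) (w' (t + 1))) ∧
      (∀ t ≤ p', ∃ s ≤ p, w' t = w s) ∧
      (∀ a b, a ≤ p' → b ≤ p' → w' a = w' b → a = b) := by
  classical
  let P : ℕ → Prop := fun p' => ∃ w' : ℕ → V, w' 0 = w 0 ∧ w' p' = w p ∧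
      (∀ t < p', E (w' t) (w' (t + 1))) ∧ (∀ t ≤ p', ∃ s ≤ p, w' t = w s)
  have hP : ∃ p', P p' := ⟨p, w, rfl, rfl, hw, fun t ht => ⟨t, ht, rfl⟩⟩
  obtain ⟨w', h0, h1, h2, h3⟩ := Nat.find_spec hP
  have hmin : ∀ m < Nat.find hP, ¬ P m := fun m hm => Nat.find_min hP hm
  generalize Nat.find hP = q at *
  have main : ∀ a b, a < b → b ≤ q → w' a ≠ w' b := by
    intro a b hab hb heq
    apply hmin (q - (b - a)) (by omega)
    refine ⟨fun t => if t ≤ a then w' t else w' (t + (b - a)), by simpa using h0, ?_, ?_, ?_⟩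
    · by_cases h : q - (b - a) ≤ a
      · have hbq : b = q := by omega
        have : q - (b - a) = a := by omega
        simp only [this, le_refl, if_true]
        rw [heq, hbq, h1]
      · simp only [h, if_false]
        rw [← h1]; congr 1; omega
    · intro t ht
      rcases lt_trichotomy t a with h | h | h
      · have h' : t + 1 ≤ a := h
        simp only [h.le, h', if_true]
        exact h2 t (by omega)
      · subst h
        have h' : ¬ (t + 1 ≤ t) := by omega
        simp only [le_refl, h', if_true, if_false]
        rw [heq]
        have : t + 1 + (b - t) = b + 1 := by omega
        rw [this]
        exact h2 b (by omega)
      · have h' : ¬ (t + 1 ≤ a) := by omega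
        have h'' : ¬ (t ≤ a) := by omega
        simp only [h', h'', if_false]
        have : t + 1 + (b - a) = t + (b - a) + 1 := by omega
        rw [this]
        exact h2 _ (by omega)
    · intro t ht
      by_cases h : t ≤ a
      · simp only [h, if_true]; exact h3 t (by omega)
      · simp only [h, if_false]; exact h3 _ (by omega)
  refine ⟨q, w', h0, h1, h2, h3, ?_⟩
  intro a b ha hb hab
  rcases lt_trichotomy a b with h | h | h
  · exact absurd hab (main a b h hb)
  · exact h
  · exact absurd hab.symm (main b a h ha)

/-- Disjoint simple walks from `u` to `s` force the minor of the path matrix to be nonzero. -/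
theorem minor_ne_zero_simple {n k : ℕ} (Dr : Fin n → Fin n → Prop) [DecidableRel Dr]
    (M A : Matrix (Fin n) (Fin n) (MvPowerSeries ((Fin n × Fin n) ⊕ Fin n) ℚ))
    (hM : ∀ i j, M i j = if Dr i j then MvPowerSeries.X (Sum.inl (i, j)) else 0)
    (hA : (1 - M) * A = 1) (u s : Fin k → Fin n) (hs : Function.Injective s)
    (τ : Equiv.Perm (Fin k)) (p : Fin k → ℕ) (w : Fin k → ℕ → Fin n)
    (h0 : ∀ j, w j 0 = u j) (h1 : ∀ j, w j (p j) = s (τ j))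
    (h2 : ∀ j, ∀ t < p j, Dr (w j t) (w j (t + 1)))
    (hdis : ∀ i j a b, a ≤ p i → b ≤ p j → w i a = w j b → i = j ∧ a = b) :
    (A.submatrix u s).det ≠ 0 := by
  classical
  intro hdet
  obtain ⟨φ, hφ1, hφ2⟩ := exists_kill (σ := (Fin n × Fin n) ⊕ Fin n)
    (fun x => ∃ j t, t < p j ∧ x = Sum.inl (w j t, w j (t + 1)))
  have hA' : (1 - φ.mapMatrix M) * φ.mapMatrix A = 1 := by
    have := congrArg φ.mapMatrix hA
    simpa only [map_mul, map_sub, map_one] using this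
  have hdet' : ((φ.mapMatrix A).submatrix u s).det = 0 := by
    have := congrArg φ hdet
    rw [RingHom.map_det, map_zero] at this
    exact this
  set A' := φ.mapMatrix A with hA'def
  set M' := φ.mapMatrix M with hM'def
  have hM'1 : ∀ j, ∀ t < p j, M' (w j t) (w j (t + 1))
      = MvPowerSeries.X (Sum.inl (w j t, w j (t + 1))) := by
    intro j t ht
    simp only [hM'def, RingHom.mapMatrix_apply, Matrix.map_apply, hM, if_pos (h2 j t ht)]
    exact hφ1 _ ⟨j, t, ht, rfl⟩
  have hM'0 : ∀ a b, (¬ ∃ j t, t < p j ∧ a = w j t ∧ b = w j (t + 1)) → M' a b = 0 := by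
    intro a b hab
    simp only [hM'def, RingHom.mapMatrix_apply, Matrix.map_apply, hM]
    split_ifs
    · apply hφ2
      rintro ⟨j, t, ht, e⟩
      simp only [Sum.inl.injEq, Prod.mk.injEq] at e
      exact hab ⟨j, t, ht, e.1, e.2⟩
    · simp
  have : IsDomain (MvPowerSeries ((Fin n × Fin n) ⊕ Fin n) ℚ) := NoZeroDivisors.to_isDomain _
  obtain ⟨z, hz, hz0⟩ := Matrix.exists_mulVec_eq_zero_iff.mpr hdet'
  apply hz
  let x : Fin n → MvPowerSeries ((Fin n × Fin n) ⊕ Fin n) ℚ :=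
    fun v => ∑ l, if v = s l then z l else 0
  let y := A' *ᵥ x
  have hy : ∀ v, y v = ∑ l, A' v (s l) * z l := by
    intro v
    simp only [y, x, Matrix.mulVec, dotProduct, Finset.mul_sum]
    rw [Finset.sum_comm]
    simp
  have hyx : ∀ v, y v = ∑ b, M' v b * y b + x v := by
    intro v
    have : (1 - M') *ᵥ y = x := by
      simp only [y, Matrix.mulVec_mulVec, hA', Matrix.one_mulVec]
    have := congrFun this v
    rw [Matrix.sub_mulVec, Matrix.one_mulVec, Pi.sub_apply] at this
    rw [← this]
    simp [Matrix.mulVec, dotProduct]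
  have hyu : ∀ j, y (u j) = 0 := by
    intro j
    rw [hy]
    exact congrFun hz0 j
  have hxw : ∀ j, ∀ t < p j, x (w j t) = 0 := by
    intro j t ht
    apply Finset.sum_eq_zero
    intro l _
    rw [if_neg]
    intro e
    have : w (τ.symm l) (p (τ.symm l)) = s l := by rw [h1]; simp
    rw [← this] at e
    obtain ⟨e1, e2⟩ := hdis _ _ _ _ ht.le le_rfl e
    subst e1
    omega
  have hyw : ∀ j t, t ≤ p j → y (w j t) = 0 := by
    intro j t
    induction t with
    | zero => intro _; rw [h0]; exact hyu j
    | succ t ih =>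
      intro ht
      have e := hyx (w j t)
      rw [ih (by omega), hxw j t ht, add_zero, Finset.sum_eq_single (w j (t + 1)), hM'1 j t ht] at e
      · rcases mul_eq_zero.mp e.symm with h | h
        · exact absurd h (X_ne_zero_aux _)
        · exact h
      · intro b _ hb
        rw [hM'0, zero_mul]
        rintro ⟨j', t', ht', e1, e2⟩
        obtain ⟨rfl, rfl⟩ := hdis _ _ _ _ (by omega) ht'.le e1
        exact hb e2
      · simp
  funext l
  obtain ⟨j, rfl⟩ := τ.surjective l
  have e := hyx (w j (p j))
  rw [hyw j _ le_rfl, Finset.sum_eq_zero, zero_add] at e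
  · rw [Pi.zero_apply, e]
    simp only [x, h1, hs.eq_iff]
    simp
  · intro b _
    rw [hM'0, zero_mul]
    rintro ⟨j', t', ht', e1, e2⟩
    obtain ⟨rfl, e3⟩ := hdis _ _ _ _ le_rfl ht'.le e1
    omega

theorem minor_ne_zero {n k : ℕ} (Dr : Fin n → Fin n → Prop) [DecidableRel Dr]
    (M A : Matrix (Fin n) (Fin n) (MvPowerSeries ((Fin n × Fin n) ⊕ Fin n) ℚ))
    (hM : ∀ i j, M i j = if Dr i j then MvPowerSeries.X (Sum.inl (i, j)) else 0)
    (hA : (1 - M) * A = 1) (u s : Fin k → Fin n) (hs : Function.Injective s)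
    (τ : Equiv.Perm (Fin k)) (p : Fin k → ℕ) (w : Fin k → ℕ → Fin n)
    (h0 : ∀ j, w j 0 = u j) (h1 : ∀ j, w j (p j) = s (τ j))
    (h2 : ∀ j, ∀ t < p j, Dr (w j t) (w j (t + 1)))
    (hdis : ∀ i j a b, a ≤ p i → b ≤ p j → w i a = w j b → i = j) :
    (A.submatrix u s).det ≠ 0 := by
  choose p' w' e0 e1 e2 e3 e4 using fun j => exists_simple_walk Dr (p j) (w j) (h2 j)
  refine minor_ne_zero_simple Dr M A hM hA u s hs τ p' w' (fun j => (e0 j).trans (h0 j))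
    (fun j => (e1 j).trans (h1 j)) e2 ?_
  intro i j a b ha hb hab
  obtain ⟨a', ha', ea⟩ := e3 i a ha
  obtain ⟨b', hb', eb⟩ := e3 j b hb
  have : i = j := hdis i j a' b' ha' hb' (by rw [← ea, ← eb, hab])
  subst this
  exact ⟨rfl, e4 i a b ha hb hab⟩

/-- Tracing the cycles of a permutation through the border. -/
theorem perm_trace {α : Type*} [Finite α] {k : ℕ} (σ : Equiv.Perm (α ⊕ Fin k)) :
    ∃ (N : Fin k → ℕ) (τ : Equiv.Perm (Fin k)), (∀ j, 0 < N j) ∧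
      (∀ j, (σ ^ N j) (Sum.inr j) = Sum.inr (τ j)) ∧
      (∀ j t, 0 < t → t < N j → ∃ a, (σ ^ t) (Sum.inr j) = Sum.inl a) ∧
      (∀ i j a b, 0 < a → a < N i → 0 < b → b < N j →
        (σ ^ a) (Sum.inr i) = (σ ^ b) (Sum.inr j) → i = j ∧ a = b) := by
  classical
  have hex : ∀ j : Fin k, ∃ N, 0 < N ∧ ∃ l : Fin k, (σ ^ N) (Sum.inr j) = Sum.inr l :=
    fun j => ⟨orderOf σ, orderOf_pos σ, j, by rw [pow_orderOf_eq_one]; rfl⟩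
  let N := fun j => Nat.find (hex j)
  have hN : ∀ j, 0 < N j ∧ ∃ l : Fin k, (σ ^ N j) (Sum.inr j) = Sum.inr l :=
    fun j => Nat.find_spec (hex j)
  have hmin : ∀ j t, 0 < t → t < N j → ¬ ∃ l : Fin k, (σ ^ t) (Sum.inr j) = Sum.inr l :=
    fun j t h0 ht h => Nat.find_min (hex j) ht ⟨h0, h⟩
  choose f hf using fun j => (hN j).2
  have aux : ∀ i j a b, a ≤ b → b ≤ N j → 0 < a →
      (σ ^ a) (Sum.inr i) = (σ ^ b) (Sum.inr j) → i = j ∧ a = b := by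
    intro i j a b hab hb h0 e
    have e' : (Sum.inr i : α ⊕ Fin k) = (σ ^ (b - a)) (Sum.inr j) := by
      apply (σ ^ a).injective
      rw [e, ← Equiv.Perm.mul_apply, ← pow_add]
      congr 2; omega
    rcases Nat.eq_or_lt_of_le hab with h | h
    · subst h
      refine ⟨?_, rfl⟩
      simpa using e'
    · exact absurd ⟨i, e'.symm⟩ (hmin j (b - a) (by omega) (by omega))
  have aux2 : ∀ i j a b, a ≤ N i → b ≤ N j → 0 < a → 0 < b →
      (σ ^ a) (Sum.inr i) = (σ ^ b) (Sum.inr j) → i = j ∧ a = b := by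
    intro i j a b ha hb ha0 hb0 e
    rcases le_total a b with h | h
    · exact aux i j a b h hb ha0 e
    · obtain ⟨h1, h2⟩ := aux j i b a h ha hb0 e.symm
      exact ⟨h1.symm, h2.symm⟩
  have finj : Function.Injective f := by
    intro i j e
    exact (aux2 i j (N i) (N j) le_rfl le_rfl (hN i).1 (hN j).1 (by rw [hf, hf, e])).1
  refine ⟨N, Equiv.ofBijective f (Finite.injective_iff_bijective.mp finj), fun j => (hN j).1, ?_,
    ?_, ?_⟩
  · intro j; simpa using hf j
  · intro j t h0 ht
    rcases h : (σ ^ t) (Sum.inr j) with a | l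
    · exact ⟨a, rfl⟩
    · exact absurd ⟨l, h⟩ (hmin j t h0 ht)
  · intro i j a b ha0 ha hb0 hb e
    exact aux2 i j a b ha.le hb.le ha0 hb0 e

/-- Nonvanishing of the minor yields a permutation supported on the bordered matrix. -/
theorem exists_perm_of_det_ne_zero {n k : ℕ} {R : Type*} [CommRing R]
    (LamL LamR Om AL AR : Matrix (Fin n) (Fin n) R)
    (hL : (1 - LamL) * AL = 1) (hR : (1 - LamR) * AR = 1) (S T : Fin k → Fin n)
    (hdet : ((ALᵀ * Om * AR).submatrix S T).det ≠ 0) :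
    ∃ σ : Equiv.Perm ((Fin n ⊕ Fin n) ⊕ Fin k), ∀ x,
      (Matrix.fromBlocks (Matrix.fromBlocks (1 - LamL)ᵀ (-Om) 0 (1 - LamR))
        (Matrix.of fun x j => if x = Sum.inr (T j) then (1 : R) else 0)
        (Matrix.of fun j x => if x = Sum.inl (S j) then (1 : R) else 0)
        (0 : Matrix (Fin k) (Fin k) R)) x (σ x) ≠ 0 := by
  classical
  set P := Matrix.fromBlocks (1 - LamL)ᵀ (-Om) 0 (1 - LamR) with hP
  set Q := Matrix.fromBlocks ALᵀ (ALᵀ * Om * AR) 0 AR with hQ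
  set B : Matrix (Fin n ⊕ Fin n) (Fin k) R :=
    Matrix.of fun x j => if x = Sum.inr (T j) then (1 : R) else 0 with hB
  set C : Matrix (Fin k) (Fin n ⊕ Fin n) R :=
    Matrix.of fun j x => if x = Sum.inl (S j) then (1 : R) else 0 with hC
  have hLt : (1 - LamL)ᵀ * ALᵀ = 1 := by
    rw [← Matrix.transpose_mul, mul_eq_one_comm.mp hL, Matrix.transpose_one]
  have hPQ : P * Q = 1 := by
    rw [hP, hQ, Matrix.fromBlocks_multiply, ← Matrix.fromBlocks_one]
    congr 1
    · rw [hLt]; simp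
    · rw [Matrix.mul_assoc ALᵀ, ← Matrix.mul_assoc, hLt]; simp
    · simp
    · simp [hR]
  let : Invertible P := ⟨Q, mul_eq_one_comm.mp hPQ, hPQ⟩
  have hinv : ⅟P = Q := rfl
  have hCQB : C * Q * B = (ALᵀ * Om * AR).submatrix S T := by
    ext i j
    simp only [Matrix.mul_apply (M := C * Q), hB, Matrix.of_apply, mul_ite, mul_one, mul_zero,
      Finset.sum_ite_eq', Finset.sum_ite_eq, Finset.mem_univ, if_true]
    rw [Matrix.mul_apply]
    simp only [C, Matrix.of_apply, ite_mul, one_mul, zero_mul,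
      Finset.sum_ite_eq', Finset.mem_univ, if_true]
    simp [hQ]
  have hne : (Matrix.fromBlocks P B C 0).det ≠ 0 := by
    rw [Matrix.det_fromBlocks₁₁, hinv, hCQB, zero_sub, Matrix.det_neg]
    intro h
    have hu : IsUnit P.det := Matrix.isUnit_det_of_invertible P
    rw [hu.mul_right_eq_zero] at h
    rw [IsUnit.mul_right_eq_zero] at h
    · exact hdet h
    · exact (isUnit_one.neg).pow _
  by_contra hcon
  push Not at hcon
  apply hne
  rw [← Matrix.det_transpose, Matrix.det_apply]
  apply Finset.sum_eq_zero
  intro σ _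
  obtain ⟨x, hx⟩ := hcon σ
  rw [Finset.prod_eq_zero (Finset.mem_univ x) (by simpa using hx), smul_zero]

/-- Combinatorial core: a supported permutation gives a system of treks. -/
theorem exists_trek_system {n k : ℕ} (DL DR : Fin n → Fin n → Prop) (S T : Fin k → Fin n)
    (σ : Equiv.Perm ((Fin n ⊕ Fin n) ⊕ Fin k))
    (hb : ∀ j, σ (Sum.inr j) = Sum.inl (Sum.inl (S j)))
    (hl : ∀ v, (∃ w, σ (Sum.inl (Sum.inl v)) = Sum.inl (Sum.inl w) ∧ (w = v ∨ DL w v)) ∨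
      σ (Sum.inl (Sum.inl v)) = Sum.inl (Sum.inr v))
    (hr : ∀ v, (∃ w, σ (Sum.inl (Sum.inr v)) = Sum.inl (Sum.inr w) ∧ (w = v ∨ DR v w)) ∨
      ∃ j, v = T j ∧ σ (Sum.inl (Sum.inr v)) = Sum.inr j) :
    ∃ (τ : Equiv.Perm (Fin k)) (p q : Fin k → ℕ) (L R : Fin k → ℕ → Fin n),
      (∀ j, L j 0 = S j) ∧ (∀ j, R j (q j) = T (τ j)) ∧ (∀ j, L j (p j) = R j 0) ∧
      (∀ j, ∀ t < p j, DL (L j (t + 1)) (L j t)) ∧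
      (∀ j, ∀ t < q j, DR (R j t) (R j (t + 1))) ∧
      (∀ i j a b, a ≤ p i → b ≤ p j → L i a = L j b → i = j) ∧
      (∀ i j a b, a ≤ q i → b ≤ q j → R i a = R j b → i = j) := by
  classical
  obtain ⟨N, τ, hN0, hNτ, hNl, hNd⟩ := perm_trace σ
  have hstep : ∀ t x, (σ ^ (t + 1)) x = σ ((σ ^ t) x) := by
    intro t x; rw [pow_succ', Equiv.Perm.mul_apply]
  -- no fixed point on an orbit of the border
  have hfix : ∀ j t, σ ((σ ^ t) (Sum.inr j)) ≠ (σ ^ t) (Sum.inr j) := by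
    intro j t h
    rw [← Equiv.Perm.mul_apply, ← pow_succ', pow_succ, Equiv.Perm.mul_apply] at h
    have := (σ ^ t).injective h
    rw [hb] at this
    cases this
  have main : ∀ j, ∃ (p q : ℕ) (L R : ℕ → Fin n), p + q + 3 = N j ∧
      (∀ t ≤ p, (σ ^ (t + 1)) (Sum.inr j) = Sum.inl (Sum.inl (L t))) ∧
      (∀ t ≤ q, (σ ^ (t + p + 2)) (Sum.inr j) = Sum.inl (Sum.inr (R t))) := by
    intro j
    let g : (Fin n ⊕ Fin n) ⊕ Fin k → Fin n := Sum.elim (Sum.elim id id) S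
    have hx1 : (σ ^ 1) (Sum.inr j) = Sum.inl (Sum.inl (S j)) := by rw [pow_one, hb]
    have hex : ∃ p, ¬ ∃ v, (σ ^ (p + 2)) (Sum.inr j) = Sum.inl (Sum.inl v) := by
      refine ⟨N j - 2, ?_⟩
      rintro ⟨v, hv⟩
      have h1 : N j ≠ 1 := by
        intro h; have := hNτ j; rw [h, hx1] at this; cases this
      have : N j - 2 + 2 = N j := by have := hN0 j; omega
      rw [this, hNτ] at hv
      cases hv
    have hp1 := Nat.find_spec hex
    have hp2 : ∀ t < Nat.find hex, ∃ v, (σ ^ (t + 2)) (Sum.inr j) = Sum.inl (Sum.inl v) :=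
      fun t ht => not_not.mp (Nat.find_min hex ht)
    generalize Nat.find hex = p at hp1 hp2
    have hleft : ∀ t ≤ p, ∃ v, (σ ^ (t + 1)) (Sum.inr j) = Sum.inl (Sum.inl v) := by
      intro t ht
      rcases t with _ | t
      · exact ⟨_, hx1⟩
      · exact hp2 t (by omega)
    have hNp : ∀ t ≤ p + 1, t < N j := by
      intro t
      induction t with
      | zero => intro _; exact hN0 j
      | succ t ih =>
        intro ht
        have h1 := ih (by omega)
        rcases Nat.lt_or_ge (t + 1) (N j) with h | h
        · exact h
        · have : t + 1 = N j := by omega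
          obtain ⟨v, hv⟩ := hleft t (by omega)
          rw [this, hNτ] at hv
          cases hv
    have htop : ∃ v, (σ ^ (p + 2)) (Sum.inr j) = Sum.inl (Sum.inr v) := by
      obtain ⟨v, hv⟩ := hleft p le_rfl
      rcases hl v with ⟨w, hw, _⟩ | hw
      · exact absurd ⟨w, by rw [hstep, hv, hw]⟩ hp1
      · exact ⟨v, by rw [hstep, hv, hw]⟩
    have hNp2 : p + 2 < N j := by
      have h1 := hNp (p + 1) le_rfl
      rcases Nat.lt_or_ge (p + 2) (N j) with h | h
      · exact h
      · have : p + 2 = N j := by omega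
        obtain ⟨v, hv⟩ := htop
        rw [this, hNτ] at hv
        cases hv
    have hright : ∀ t, t + p + 2 < N j →
        ∃ v, (σ ^ (t + p + 2)) (Sum.inr j) = Sum.inl (Sum.inr v) := by
      intro t
      induction t with
      | zero => intro _; simpa using htop
      | succ t ih =>
        intro ht
        obtain ⟨v, hv⟩ := ih (by omega)
        have e : t + 1 + p + 2 = (t + p + 2) + 1 := by omega
        rcases hr v with ⟨w, hw, _⟩ | ⟨l, _, hw⟩
        · exact ⟨w, by rw [e, hstep, hv, hw]⟩
        · obtain ⟨a, ha⟩ := hNl j _ (by omega) ht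
          rw [e, hstep, hv, hw] at ha
          cases ha
    refine ⟨p, N j - p - 3, fun t => g ((σ ^ (t + 1)) (Sum.inr j)),
      fun t => g ((σ ^ (t + p + 2)) (Sum.inr j)), by omega, ?_, ?_⟩
    · intro t ht
      obtain ⟨v, hv⟩ := hleft t ht
      simp only [hv, g, Sum.elim_inl, id]
    · intro t ht
      obtain ⟨v, hv⟩ := hright t (by omega)
      simp only [hv, g, Sum.elim_inl, Sum.elim_inr, id]
  choose p q L R hpq hL hR using main
  refine ⟨τ, p, q, L, R, ?_, ?_, ?_, ?_, ?_, ?_, ?_⟩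
  · intro j
    have := hL j 0 (Nat.zero_le _)
    rw [zero_add, pow_one, hb] at this
    simpa using this.symm
  · intro j
    have h := hR j (q j) le_rfl
    have e : N j = (q j + p j + 2) + 1 := by have := hpq j; omega
    have h2 := hNτ j
    rw [e, hstep, h] at h2
    rcases hr (R j (q j)) with ⟨w, hw, _⟩ | ⟨l, hl', hw⟩
    · rw [hw] at h2; cases h2
    · rw [hw] at h2
      rw [hl', Sum.inr.inj h2]
  · intro j
    have h := hL j (p j) le_rfl
    have h2 := hR j 0 (Nat.zero_le _)
    rw [zero_add, hstep, h] at h2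
    rcases hl (L j (p j)) with ⟨w, hw, _⟩ | hw
    · rw [hw] at h2; cases h2
    · rw [hw] at h2
      simpa using h2
  · intro j t ht
    have h := hL j t ht.le
    have h2 := hL j (t + 1) ht
    have hf := hfix j (t + 1)
    rw [hstep, h] at h2
    rw [h] at hf
    rcases hl (L j t) with ⟨w, hw, hw2⟩ | hw
    · rw [hw] at h2 hf
      have e : w = L j (t + 1) := by simpa using h2
      subst e
      rcases hw2 with e | e
      · rw [e] at hf; exact absurd rfl hf
      · exact e
    · rw [hw] at h2; cases h2
  · intro j t ht
    have h := hR j t ht.le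
    have h2 := hR j (t + 1) ht
    have hf := hfix j (t + p j + 2)
    have e : t + 1 + p j + 2 = (t + p j + 2) + 1 := by omega
    rw [e, hstep, h] at h2
    rw [h] at hf
    rcases hr (R j t) with ⟨w, hw, hw2⟩ | ⟨l, _, hw⟩
    · rw [hw] at h2 hf
      have e : w = R j (t + 1) := by simpa using h2
      subst e
      rcases hw2 with e | e
      · rw [e] at hf; exact absurd rfl hf
      · exact e
    · rw [hw] at h2; cases h2
  · intro i j a b ha hb' e
    have h1 := hpq i
    have h2 := hpq j
    exact (hNd i j (a + 1) (b + 1) (by omega) (by omega) (by omega) (by omega)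
      (by rw [hL i a ha, hL j b hb', e])).1
  · intro i j a b ha hb' e
    have h1 := hpq i
    have h2 := hpq j
    exact (hNd i j (a + p i + 2) (b + p j + 2) (by omega) (by omega) (by omega) (by omega)
      (by rw [hR i a ha, hR j b hb', e])).1

/-- **Vanishing determinants and avoiding trek systems, `B = ∅`.**
Let `G = (V, D, ∅)` be a mixed graph without bidirected edges, with
indeterminate matrix `Λ` supported on `D`, diagonal indeterminate matrix `Ω`,
subsets `D_L, D_R ⊂ D` with corresponding restrictions `Λ^L, Λ^R` of `Λ`, and
`Γ = (I - Λ^L)⁻ᵀ Ω (I - Λ^R)⁻¹` (the inverses being the formal geometric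
series `AL`, `AR`).  For `S, T ⊂ V` with `|S| = |T| = k`, the determinant
`|Γ_{S,T}|` is the zero power series if and only if every system of `k` treks
from `S` to `T` avoiding `D ∖ D_L` on the left and `D ∖ D_R` on the right
(i.e. using only `D_L`-edges on the left and `D_R`-edges on the right) has a
sided intersection. -/
theorem det_zero_iff_avoiding_systems_intersect {n k : ℕ} (G : MixedGraph n)
    [DecidableRel G.D] [DecidableEq (Fin n)]
    (hB : ∀ i j, ¬ G.B i j)
    (DL DR : Fin n → Fin n → Prop) [DecidableRel DL] [DecidableRel DR]
    (hDL : ∀ i j, DL i j → G.D i j) (hDR : ∀ i j, DR i j → G.D i j)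
    (LamL LamR Om : Matrix (Fin n) (Fin n) (MvPowerSeries ((Fin n × Fin n) ⊕ Fin n) ℚ))
    (hLamL : ∀ i j, LamL i j = if DL i j then MvPowerSeries.X (Sum.inl (i, j)) else 0)
    (hLamR : ∀ i j, LamR i j = if DR i j then MvPowerSeries.X (Sum.inl (i, j)) else 0)
    (hOm : ∀ i j, Om i j = if i = j then MvPowerSeries.X (Sum.inr i) else 0)
    (AL AR : Matrix (Fin n) (Fin n) (MvPowerSeries ((Fin n × Fin n) ⊕ Fin n) ℚ))
    (hAL : ∀ i j, HasSum (fun m : ℕ => (LamL ^ m) i j) (AL i j))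
    (hAR : ∀ i j, HasSum (fun m : ℕ => (LamR ^ m) i j) (AR i j))
    (Gam : Matrix (Fin n) (Fin n) (MvPowerSeries ((Fin n × Fin n) ⊕ Fin n) ℚ))
    (hGam : Gam = ALᵀ * Om * AR)
    (S T : Fin k → Fin n) (hS : Function.Injective S) (hT : Function.Injective T) :
    (Gam.submatrix S T).det = 0 ↔
      ∀ (τ : Equiv.Perm (Fin k)) (π : ∀ i, Trek G (S i) (T (τ i))),
        (∀ i, (∀ e : Fin (π i).p, DL ((π i).L e.succ) ((π i).L e.castSucc)) ∧
          (∀ e : Fin (π i).q, DR ((π i).R e.castSucc) ((π i).R e.succ))) →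
        ∃ i j, i ≠ j ∧
          (¬ Disjoint (π i).leftVerts (π j).leftVerts ∨
            ¬ Disjoint (π i).rightVerts (π j).rightVerts) := by
  rename_i instE _ _
  obtain rfl : instE = instDecidableEqFin n := Subsingleton.elim _ _
  have hL := one_sub_mul_geom LamL AL hAL
  have hR := one_sub_mul_geom LamR AR hAR
  subst hGam
  constructor
  · intro hdet τ π hav
    by_contra hcon
    push Not at hcon
    -- the tops
    let u : Fin k → Fin n := fun i => (π i).R 0
    have htop : ∀ i, (π i).L (Fin.last _) = u i := by
      intro i
      have h := (π i).hconn
      rcases hbid : (π i).bid with _ | _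
      · simpa [hbid] using h
      · rw [hbid] at h
        exact absurd h (by simpa using hB _ _)
    have hdL : ∀ i j a b, (π i).L a = (π j).L b → i = j := by
      intro i j a b e
      by_contra hij
      exact Set.disjoint_left.mp (hcon i j hij).1 ⟨a, rfl⟩ ⟨b, e.symm⟩
    have hdR : ∀ i j a b, (π i).R a = (π j).R b → i = j := by
      intro i j a b e
      by_contra hij
      exact Set.disjoint_left.mp (hcon i j hij).2 ⟨a, rfl⟩ ⟨b, e.symm⟩
    have hu : Function.Injective u := fun i j e => hdR i j 0 0 e
    have hne1 : (AL.submatrix u S).det ≠ 0 := by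
      refine minor_ne_zero DL LamL AL hLamL hL u S hS 1 (fun j => (π j).p)
        (fun j t => (π j).L ⟨(π j).p - t, by omega⟩) ?_ ?_ ?_ ?_
      · intro j
        rw [← htop]; rfl
      · intro j
        simp only [Nat.sub_self, Equiv.Perm.coe_one, id]
        exact (π j).hv
      · intro j t ht
        have h := (hav j).1 ⟨(π j).p - (t + 1), by omega⟩
        convert h using 2
        all_goals first
          | rfl
          | (congr 1; apply Fin.ext; simp; omega)
          | (apply Fin.ext; simp; omega)
      · intro i j a b _ _ e
        exact hdL _ _ _ _ e
    have hne2 : (AR.submatrix u T).det ≠ 0 := by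
      refine minor_ne_zero DR LamR AR hLamR hR u T hT τ (fun j => (π j).q)
        (fun j t => (π j).R ⟨min t (π j).q, by omega⟩) ?_ ?_ ?_ ?_
      · intro j
        simp only [Nat.zero_min]; rfl
      · intro j
        simp only [min_self]
        exact (π j).hw
      · intro j t ht
        have h := (hav j).2 ⟨t, ht⟩
        convert h using 2
        · ext; simp; omega
        · ext; simp; omega
      · intro i j a b _ _ e
        exact hdR _ _ _ _ e
    obtain ⟨φ, hφ1, hφ2⟩ := exists_kill (σ := (Fin n × Fin n) ⊕ Fin n)
      (fun x => (∃ e, x = Sum.inl e) ∨ ∃ j, x = Sum.inr (u j))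
    have hφL : φ.mapMatrix LamL = LamL := by
      ext1 i j
      simp only [RingHom.mapMatrix_apply, Matrix.map_apply, hLamL]
      split_ifs
      · exact hφ1 _ (Or.inl ⟨_, rfl⟩)
      · simp
    have hφR : φ.mapMatrix LamR = LamR := by
      ext1 i j
      simp only [RingHom.mapMatrix_apply, Matrix.map_apply, hLamR]
      split_ifs
      · exact hφ1 _ (Or.inl ⟨_, rfl⟩)
      · simp
    have hφAL : φ.mapMatrix AL = AL := by
      have h := congrArg φ.mapMatrix hL
      simp only [map_mul, map_sub, map_one, hφL] at h
      exact (left_inv_eq_right_inv (mul_eq_one_comm.mp hL) h).symm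
    have hφAR : φ.mapMatrix AR = AR := by
      have h := congrArg φ.mapMatrix hR
      simp only [map_mul, map_sub, map_one, hφR] at h
      exact (left_inv_eq_right_inv (mul_eq_one_comm.mp hR) h).symm
    have hprod : φ.mapMatrix ((ALᵀ * Om * AR).submatrix S T) =
        (AL.submatrix u S)ᵀ * Matrix.diagonal (fun j => MvPowerSeries.X (Sum.inr (u j)))
          * AR.submatrix u T := by
      ext1 i j
      have e1 : ∀ a b, φ (AL a b) = AL a b := fun a b => congrFun (congrFun hφAL a) b
      have e2 : ∀ a b, φ (AR a b) = AR a b := fun a b => congrFun (congrFun hφAR a) b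
      simp only [RingHom.mapMatrix_apply, Matrix.map_apply, Matrix.submatrix_apply,
        Matrix.mul_apply, Matrix.transpose_apply, hOm, mul_ite, mul_zero, Finset.sum_ite_eq',
        Finset.mem_univ, if_true, map_sum, map_mul, e1, e2, Matrix.diagonal_apply]
      symm
      refine Finset.sum_of_injOn u hu.injOn (fun _ _ => Finset.mem_coe.mpr (Finset.mem_univ _))
        ?_ ?_
      · intro v _ hv
        rw [hφ2, mul_zero, zero_mul]
        rintro (⟨e, he⟩ | ⟨l, hl⟩)
        · cases he
        · exact hv ⟨l, by simp, (Sum.inr.inj hl).symm⟩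
      · intro l _
        rw [hφ1 _ (Or.inr ⟨l, rfl⟩)]
    have h := congrArg φ hdet
    rw [RingHom.map_det, map_zero, hprod, Matrix.det_mul, Matrix.det_mul, Matrix.det_transpose,
      Matrix.det_diagonal] at h
    have hX : ∏ j, (MvPowerSeries.X (Sum.inr (u j)) :
        MvPowerSeries ((Fin n × Fin n) ⊕ Fin n) ℚ) ≠ 0 :=
      Finset.prod_ne_zero_iff.mpr (fun j _ => X_ne_zero_aux _)
    exact mul_ne_zero (mul_ne_zero hne1 hX) hne2 h
  · intro hsys
    by_contra hdet
    obtain ⟨σ, hσ⟩ := exists_perm_of_det_ne_zero LamL LamR Om AL AR hL hR S T hdet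
    obtain ⟨τ, p, q, L, R, h0, h1, h2, h3, h4, h5, h6⟩ := exists_trek_system DL DR S T σ
      (by
        intro j
        have h := hσ (Sum.inr j)
        rcases hx : σ (Sum.inr j) with (v | v) | l
        · rw [hx] at h
          simp at h
          rw [h]
        · rw [hx] at h
          simp at h
        · rw [hx] at h
          simp at h)
      (by
        intro v
        have h := hσ (Sum.inl (Sum.inl v))
        rcases hx : σ (Sum.inl (Sum.inl v)) with (w | w) | l
        · left
          refine ⟨w, rfl, ?_⟩
          rw [hx] at h
          by_contra hc
          push Not at hc
          apply h
          simp [hLamL, hc.2, Matrix.one_apply, hc.1.symm]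
        · right
          rw [hx] at h
          by_contra hc
          apply h
          have : v ≠ w := fun e => hc (by rw [e])
          simp [hOm, this]
        · rw [hx] at h
          simp at h)
      (by
        intro v
        have h := hσ (Sum.inl (Sum.inr v))
        rcases hx : σ (Sum.inl (Sum.inr v)) with (w | w) | l
        · rw [hx] at h
          simp at h
        · left
          refine ⟨w, rfl, ?_⟩
          rw [hx] at h
          by_contra hc
          push Not at hc
          apply h
          simp [hLamR, hc.2, Matrix.one_apply, hc.1.symm]
        · right
          rw [hx] at h
          refine ⟨l, ?_, rfl⟩
          simpa using h)
    obtain ⟨i, j, hij, h⟩ := hsys τ (fun i =>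
      { p := p i
        q := q i
        L := fun t => L i t
        R := fun t => R i t
        hL := fun t => hDL _ _ (by simpa using h3 i t t.2)
        hR := fun t => hDR _ _ (by simpa using h4 i t t.2)
        bid := false
        hconn := by simpa using h2 i
        hv := by simpa using h0 i
        hw := by simpa using h1 i })
      (fun i => ⟨fun t => by simpa using h3 i t t.2, fun t => by simpa using h4 i t t.2⟩)
    rcases h with h | h
    · obtain ⟨x, ⟨a, ha⟩, ⟨b, hb⟩⟩ := Set.not_disjoint_iff.mp h
      exact hij (h5 i j a b (Nat.lt_succ_iff.mp a.2) (Nat.lt_succ_iff.mp b.2) (ha.trans hb.symm))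
    · obtain ⟨x, ⟨a, ha⟩, ⟨b, hb⟩⟩ := Set.not_disjoint_iff.mp h
      exact hij (h6 i j a b (Nat.lt_succ_iff.mp a.2) (Nat.lt_succ_iff.mp b.2) (ha.trans hb.symm))
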